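/- Let χ ≥ 1 and R ≥ 1 be integers. Define ν_k^{(1)} = 1 for 0 ≤ k ≤ 2χ, and for 2 ≤ n ≤ R define ν_k^{(n)} = k!((2χ)!)^{n−1} / (2χ(n−1)+k)! for 1 ≤ k ≤ 2χ. Then for every z ∈ ℂ: Σ_{k=0}^{2χ} z^k/k! + Σ_{n=2}^{R} (z^{2χ}/(2χ)!)^{n−1} · Σ_{k=1}^{2χ} ν_k^{(n)} z^k/k! = Σ_{j=0}^{2χR} z^j/j!. -/

import Mathlib

/-- The rescaled block of degree `m * q + k`, `1 ≤ k ≤ m`, is the corresponding piece of the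
exponential series. -/
theorem multiproduct_block_eq (m q : ℕ) (z : ℂ) :
    (z ^ m / (m.factorial : ℂ)) ^ q *
        ∑ k ∈ Finset.Icc 1 m,
          ((k.factorial : ℂ) * (m.factorial : ℂ) ^ q / ((m * q + k).factorial : ℂ)) *
            z ^ k / (k.factorial : ℂ)
      = ∑ i ∈ Finset.range m, z ^ (m * q + 1 + i) / ((m * q + 1 + i).factorial : ℂ) := by
  rw [← Finset.Ico_add_one_right_eq_Icc, Finset.sum_Ico_eq_sum_range, Finset.mul_sum]
  refine Finset.sum_congr (by simp) fun i _ => ?_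
  have hm : (m.factorial : ℂ) ≠ 0 := Nat.cast_ne_zero.mpr m.factorial_ne_zero
  have hi : ((1 + i).factorial : ℂ) ≠ 0 := Nat.cast_ne_zero.mpr (1 + i).factorial_ne_zero
  have hq : ((m * q + (1 + i)).factorial : ℂ) ≠ 0 :=
    Nat.cast_ne_zero.mpr (m * q + (1 + i)).factorial_ne_zero
  rw [add_assoc (m * q) 1 i, pow_add z (m * q), pow_mul, div_pow]
  field_simp

/-- The combinatorial identity at the core of the closed-form multi-product formula
(Definition 3): with `ν_k^{(n)} = k!((2χ)!)^{n-1}/(2χ(n-1)+k)!`, one has, for all `z ∈ ℂ`,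
`Σ_{k=0}^{2χ} z^k/k! + Σ_{n=2}^{R} (z^{2χ}/(2χ)!)^{n-1} Σ_{k=1}^{2χ} ν_k^{(n)} z^k/k!
  = Σ_{j=0}^{2χR} z^j/j!`. -/
theorem closed_form_multiproduct_identity (χ R : ℕ) (hχ : 1 ≤ χ) (hR : 1 ≤ R) (z : ℂ) :
    (∑ k ∈ Finset.range (2 * χ + 1), z ^ k / (k.factorial : ℂ)) +
      ∑ n ∈ Finset.Icc 2 R,
        (z ^ (2 * χ) / ((2 * χ).factorial : ℂ)) ^ (n - 1) *
          ∑ k ∈ Finset.Icc 1 (2 * χ),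
            ((k.factorial : ℂ) * (((2 * χ).factorial : ℂ)) ^ (n - 1) /
                ((2 * χ * (n - 1) + k).factorial : ℂ)) *
              z ^ k / (k.factorial : ℂ)
      = ∑ j ∈ Finset.range (2 * χ * R + 1), z ^ j / (j.factorial : ℂ) := by
  induction R, hR using Nat.le_induction with
  | base => simp
  | succ R hR ih =>
    rw [Finset.sum_Icc_succ_top (by omega), ← add_assoc, ih, Nat.add_sub_cancel,
      multiproduct_block_eq, show 2 * χ * (R + 1) + 1 = 2 * χ * R + 1 + 2 * χ by ring,
      Finset.sum_range_add _ (2 * χ * R + 1)]
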